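/- arXiv:1103.5407 — 6 statements merged into one kernel-verified Lean document; each statement's English description precedes it below -/
import Mathlib

section
/- Let α > 0 and κ be real with |κ| < α, and let μ, θ be real. Then ∫₀^∞ φ(θ; μ + κv, v) · ((α² − κ²)/2) · exp(−(α² − κ²)v/2) dv = ((α² − κ²)/(2α)) · exp(−α|θ − μ| + κ(θ − μ)). That is, the hyperbolic density with parameters (μ, α, κ) is the normal variance-mean mixture obtained by mixing φ(θ; μ + κv, v) over v against the generalized inverse-Gaussian density with parameters (1, 0, (α² − κ²)^{1/2}), which here is the exponential density of rate (α² − κ²)/2. -/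
open Real MeasureTheory Set

/-- The normal density with mean `m` and variance `v > 0`, evaluated at `x`. -/
noncomputable def normalPdf (x m v : ℝ) : ℝ :=
    (Real.sqrt (2 * Real.pi * v))⁻¹ * Real.exp (-(x - m) ^ 2 / (2 * v))

/-- The fundamental theorem of calculus on `(a, ∞)` for a nonnegative derivative, when the primitive
has a limit at both ends of the interval. -/
theorem integral_Ioi_of_hasDerivAt_of_nonneg_of_tendsto {g g' : ℝ → ℝ} {a m l : ℝ}
    (hderiv : ∀ x ∈ Ioi a, HasDerivAt g (g' x) x) (hg' : ∀ x ∈ Ioi a, 0 ≤ g' x)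
    (hm : Filter.Tendsto g (nhdsWithin a (Ioi a)) (nhds m))
    (hl : Filter.Tendsto g Filter.atTop (nhds l)) :
    ∫ x in Ioi a, g' x = l - m := by
  have hne : ∀ x ∈ Ioi a, Function.update g a m =ᶠ[nhds x] g := fun x hx => by
    filter_upwards [Ioi_mem_nhds hx] with y hy
    exact Function.update_of_ne (ne_of_gt hy) _ _
  have h := integral_Ioi_of_hasDerivAt_of_nonneg (g := Function.update g a m) (g' := g') (a := a)
    (l := l) ?_ (fun x hx => (hderiv x hx).congr_of_eventuallyEq (hne x hx)) hg' ?_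
  · simpa using h
  · rw [continuousWithinAt_update_same, Ici_sdiff_left]
    exact hm
  · refine hl.congr' ?_
    filter_upwards [Filter.eventually_gt_atTop a] with y hy
    exact (Function.update_of_ne (ne_of_gt hy) _ _).symm

theorem hasDerivAt_integral_gaussian (x : ℝ) :
    HasDerivAt (fun t : ℝ => ∫ s in (0 : ℝ)..t, exp (-(1 / 2) * s ^ 2)) (exp (-(1 / 2) * x ^ 2)) x :=
  (by fun_prop : Continuous fun s : ℝ => exp (-(1 / 2) * s ^ 2)).integral_hasStrictDerivAt 0 x
    |>.hasDerivAt

theorem tendsto_integral_gaussian_atTop :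
    Filter.Tendsto (fun t : ℝ => ∫ s in (0 : ℝ)..t, exp (-(1 / 2) * s ^ 2)) Filter.atTop
      (nhds (√(2 * π) / 2)) := by
  have h := intervalIntegral_tendsto_integral_Ioi (0 : ℝ)
    (integrable_exp_neg_mul_sq (b := 1 / 2) (by norm_num)).integrableOn Filter.tendsto_id
  rw [integral_gaussian_Ioi] at h
  rwa [show π / (1 / 2) = 2 * π by ring] at h

theorem tendsto_integral_gaussian_atBot :
    Filter.Tendsto (fun t : ℝ => ∫ s in (0 : ℝ)..t, exp (-(1 / 2) * s ^ 2)) Filter.atBot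
      (nhds (-(√(2 * π) / 2))) := by
  refine (tendsto_integral_gaussian_atTop.comp Filter.tendsto_neg_atBot_atTop).neg.congr fun t => ?_
  have h := intervalIntegral.integral_comp_neg (a := 0) (b := t)
    (fun s : ℝ => exp (-(1 / 2) * s ^ 2))
  simp only [neg_sq, neg_zero] at h
  rw [Function.comp_apply, h, intervalIntegral.integral_symm, neg_neg]

/-- The Laplace-type integral underlying the inverse Gaussian distribution. -/
theorem integral_inv_sqrt_mul_exp_neg_sq_div {α y : ℝ} (hα : 0 < α) (hy : 0 ≤ y) :
    ∫ v in Ioi (0 : ℝ), (√v)⁻¹ * exp (-(α * v - y) ^ 2 / (2 * v)) = √(2 * π) / α := by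
  set E : ℝ → ℝ := fun t => ∫ s in (0 : ℝ)..t, exp (-(1 / 2) * s ^ 2) with hE
  set S : ℝ := √(2 * π) / 2 with hS
  have htop : Filter.Tendsto E Filter.atTop (nhds S) := tendsto_integral_gaussian_atTop
  have hbot : Filter.Tendsto E Filter.atBot (nhds (-S)) := tendsto_integral_gaussian_atBot
  have hsqrt0 : Filter.Tendsto (fun v => α * √v) (nhdsWithin 0 (Ioi 0)) (nhds 0) := by
    have h : Continuous fun v => α * √v := by fun_prop
    simpa using (h.tendsto 0).mono_left nhdsWithin_le_nhds
  have hsqrtpos : Filter.Tendsto (fun v => √v) (nhdsWithin 0 (Ioi 0)) (nhdsWithin 0 (Ioi 0)) := by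
    refine tendsto_nhdsWithin_iff.2 ⟨?_, ?_⟩
    · simpa using (continuous_sqrt.tendsto 0).mono_left nhdsWithin_le_nhds
    · filter_upwards [self_mem_nhdsWithin] with v hv using sqrt_pos.2 hv
  have hinv := tendsto_inv_nhdsGT_zero.comp hsqrtpos
  have hsqrtTop := tendsto_sqrt_atTop.const_mul_atTop hα
  have hinvTop : Filter.Tendsto (fun v => y * (√v)⁻¹) Filter.atTop (nhds 0) := by
    simpa using (tendsto_inv_atTop_zero.comp tendsto_sqrt_atTop).const_mul y
  have key := integral_Ioi_of_hasDerivAt_of_nonneg_of_tendsto (a := 0)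
    (g := fun v => (E (α * √v - y * (√v)⁻¹) + exp (2 * α * y) * E (α * √v + y * (√v)⁻¹)) / α)
    (g' := fun v => (√v)⁻¹ * exp (-(α * v - y) ^ 2 / (2 * v)))
    (m := (-S + exp (2 * α * y) * S) / α) (l := (S + exp (2 * α * y) * S) / α)
    ?_ (fun v _ => by positivity) ?_ ?_
  · rw [key, hS]
    ring
  · intro v hv
    have hs : 0 < √v := sqrt_pos.2 hv
    have hv' : √v ^ 2 = v := sq_sqrt (le_of_lt hv)
    have h1 := (hasDerivAt_sqrt (ne_of_gt hv)).const_mul α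
    have h2 := ((hasDerivAt_sqrt (ne_of_gt hv)).inv hs.ne').const_mul y
    have hd1 := (hasDerivAt_integral_gaussian (α * √v - y * (√v)⁻¹)).comp v (h1.sub h2)
    have hd2 := (hasDerivAt_integral_gaussian (α * √v + y * (√v)⁻¹)).comp v (h1.add h2)
    have e1 : exp (-(1 / 2) * (α * √v - y * (√v)⁻¹) ^ 2) = exp (-(α * v - y) ^ 2 / (2 * v)) := by
      rw [show -(α * v - y) ^ 2 / (2 * v) = -(α * √v ^ 2 - y) ^ 2 / (2 * √v ^ 2) by rw [hv']]
      congr 1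
      field_simp
    have e2 : exp (2 * α * y) * exp (-(1 / 2) * (α * √v + y * (√v)⁻¹) ^ 2) =
        exp (-(α * v - y) ^ 2 / (2 * v)) := by
      rw [← e1, ← exp_add]
      congr 1
      field_simp
      ring
    refine ((hd1.add (hd2.const_mul (exp (2 * α * y)))).div_const α).congr_deriv ?_
    rw [← mul_assoc, e2, e1]
    field_simp
    ring
  · refine Filter.Tendsto.div_const ?_ α
    rcases hy.eq_or_lt with rfl | hy
    · have hE0 : Filter.Tendsto E (nhds 0) (nhds 0) := by
        simpa [hE] using (hasDerivAt_integral_gaussian 0).continuousAt.tendsto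
      simpa using (hE0.comp hsqrt0).add (hE0.comp hsqrt0)
    · have hy' := hinv.const_mul_atTop hy
      exact (hbot.comp (hsqrt0.add_atBot (Filter.tendsto_neg_atTop_atBot.comp hy'))).add
        ((htop.comp (hsqrt0.add_atTop hy')).const_mul _)
  · refine Filter.Tendsto.div_const ?_ α
    refine (htop.comp ?_).add ((htop.comp ?_).const_mul _)
    · simpa [sub_eq_add_neg] using hsqrtTop.atTop_add hinvTop.neg
    · exact hsqrtTop.atTop_add hinvTop

/-- The hyperbolic density with parameters `(μ, α, κ)` is the normal variance-mean mixture
obtained by mixing `φ(θ; μ + κ v, v)` over `v` against the exponential density of rate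
`(α² − κ²)/2` (the generalized inverse-Gaussian density with parameters `(1, 0, √(α² − κ²))`). -/
theorem hyperbolic_is_variance_mean_mixture (α κ μ θ : ℝ) (hα : 0 < α) (hκ : |κ| < α) :
    (∫ v in Ioi (0 : ℝ),
        normalPdf θ (μ + κ * v) v * ((α ^ 2 - κ ^ 2) / 2) *
          Real.exp (-(α ^ 2 - κ ^ 2) * v / 2)) =
      ((α ^ 2 - κ ^ 2) / (2 * α)) * Real.exp (-α * |θ - μ| + κ * (θ - μ)) := by
  have hcongr : ∀ v ∈ Ioi (0 : ℝ),
      normalPdf θ (μ + κ * v) v * ((α ^ 2 - κ ^ 2) / 2) * exp (-(α ^ 2 - κ ^ 2) * v / 2) =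
        ((√(2 * π))⁻¹ * ((α ^ 2 - κ ^ 2) / 2) * exp (-α * |θ - μ| + κ * (θ - μ))) *
          ((√v)⁻¹ * exp (-(α * v - |θ - μ|) ^ 2 / (2 * v))) := by
    intro v hv
    have hv0 : v ≠ 0 := ne_of_gt hv
    have hexp : exp (-(θ - (μ + κ * v)) ^ 2 / (2 * v)) * exp (-(α ^ 2 - κ ^ 2) * v / 2) =
        exp (-α * |θ - μ| + κ * (θ - μ)) * exp (-(α * v - |θ - μ|) ^ 2 / (2 * v)) := by
      rw [← exp_add, ← exp_add]
      congr 1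
      field_simp
      linear_combination sq_abs (θ - μ)
    rw [normalPdf, sqrt_mul (by positivity), mul_inv]
    linear_combination ((√(2 * π))⁻¹ * (√v)⁻¹ * ((α ^ 2 - κ ^ 2) / 2)) * hexp
  rw [setIntegral_congr_fun measurableSet_Ioi hcongr, integral_const_mul,
    integral_inv_sqrt_mul_exp_neg_sq_div hα (abs_nonneg _)]
  have hπ : √(2 * π) ≠ 0 := by positivity
  field_simp
end

section
/- Let q ∈ (0, 1) and let ρ_q(θ) = |θ|/2 + (q − 1/2)θ denote the check-loss function. Then for every real θ, ∫₀^∞ φ(θ; (1 − 2q)v, v) · exp(−2q(1 − q)v) dv = exp(−2ρ_q(θ)). Hence the pseudo-likelihood exp(−2ρ_q(θ)), whose negative logarithm is the check loss |θ| + (2q − 1)θ used in quantile regression for the q-th quantile, is a normal variance-mean mixture with exponentially tilted improper mixing density. -/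
open Real MeasureTheory Set

/-- The check-loss function `ρ_q(θ) = |θ|/2 + (q − 1/2)θ` for quantile level `q`. -/
noncomputable def checkLoss (q θ : ℝ) : ℝ := |θ| / 2 + (q - 1 / 2) * θ

open Filter Topology

/-- The primitive of `exp (-t² / 2)` vanishing at the origin. -/
noncomputable def gaussPrimitive (x : ℝ) : ℝ := ∫ t in (0 : ℝ)..x, Real.exp (-(1 / 2) * t ^ 2)

lemma hasDerivAt_gaussPrimitive (x : ℝ) :
    HasDerivAt gaussPrimitive (Real.exp (-(1 / 2) * x ^ 2)) x := by
  have hc : Continuous fun t : ℝ => Real.exp (-(1 / 2) * t ^ 2) := by fun_prop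
  exact intervalIntegral.integral_hasDerivAt_right (hc.intervalIntegrable _ _)
    (hc.stronglyMeasurableAtFilter _ _) hc.continuousAt

lemma gaussPrimitive_neg (x : ℝ) : gaussPrimitive (-x) = -gaussPrimitive x := by
  have h := intervalIntegral.integral_comp_neg (a := 0) (b := x)
    (fun t : ℝ => Real.exp (-(1 / 2) * t ^ 2))
  simp only [neg_sq, neg_zero] at h
  rw [gaussPrimitive, gaussPrimitive, h, intervalIntegral.integral_symm]

lemma tendsto_gaussPrimitive_atTop :
    Tendsto gaussPrimitive atTop (𝓝 (Real.sqrt (2 * Real.pi) / 2)) := by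
  have h := intervalIntegral_tendsto_integral_Ioi (μ := volume) (0 : ℝ)
    (integrable_exp_neg_mul_sq (b := 1 / 2) (by norm_num)).integrableOn tendsto_id
  rw [integral_gaussian_Ioi] at h
  convert! h using 3
  congr 1
  ring

lemma tendsto_gaussPrimitive_atBot :
    Tendsto gaussPrimitive atBot (𝓝 (-(Real.sqrt (2 * Real.pi) / 2))) := by
  have h := (tendsto_gaussPrimitive_atTop.comp tendsto_neg_atBot_atTop).neg
  refine h.congr fun x => ?_
  simp [gaussPrimitive_neg]

/-- A primitive on `(0, ∞)` of the integrand of `integral_inv_sqrt_mul_exp`. -/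
noncomputable def mixturePrimitive (a v : ℝ) : ℝ :=
  (Real.sqrt (2 * Real.pi))⁻¹ * (Real.exp (-a) * gaussPrimitive (Real.sqrt v - a / Real.sqrt v) +
    Real.exp a * gaussPrimitive (Real.sqrt v + a / Real.sqrt v))

lemma hasDerivAt_mixturePrimitive (a : ℝ) {v : ℝ} (hv : 0 < v) :
    HasDerivAt (mixturePrimitive a)
      ((Real.sqrt (2 * Real.pi * v))⁻¹ * Real.exp (-a ^ 2 / (2 * v) - v / 2)) v := by
  have hs : 0 < Real.sqrt v := Real.sqrt_pos.2 hv
  have hsq : Real.sqrt v ^ 2 = v := Real.sq_sqrt hv.le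
  have h1 : HasDerivAt Real.sqrt (1 / (2 * Real.sqrt v)) v := Real.hasDerivAt_sqrt hv.ne'
  have h2 := (hasDerivAt_const v a).div h1 hs.ne'
  have hm := (hasDerivAt_gaussPrimitive _).comp v (h1.sub h2)
  have hp := (hasDerivAt_gaussPrimitive _).comp v (h1.add h2)
  have h := ((hm.const_mul (Real.exp (-a))).add (hp.const_mul (Real.exp a))).const_mul
    (Real.sqrt (2 * Real.pi))⁻¹
  refine HasDerivAt.congr_deriv (f := mixturePrimitive a) h ?_
  have em : Real.exp (-a) * Real.exp (-(1 / 2) * (Real.sqrt v - a / Real.sqrt v) ^ 2) =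
      Real.exp (-a ^ 2 / (2 * v) - v / 2) := by
    rw [← Real.exp_add, ← hsq, Real.sqrt_sq hs.le]
    congr 1
    field_simp
    ring
  have ep : Real.exp a * Real.exp (-(1 / 2) * (Real.sqrt v + a / Real.sqrt v) ^ 2) =
      Real.exp (-a ^ 2 / (2 * v) - v / 2) := by
    rw [← Real.exp_add, ← hsq, Real.sqrt_sq hs.le]
    congr 1
    field_simp
    ring
  simp only [Pi.sub_apply, Pi.add_apply, Pi.div_apply]
  rw [← mul_assoc (Real.exp (-a)), ← mul_assoc (Real.exp a), em, ep,
    Real.sqrt_mul (show 0 ≤ 2 * Real.pi by positivity) v]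
  field_simp
  ring

lemma tendsto_mixturePrimitive_atTop (a : ℝ) :
    Tendsto (mixturePrimitive a) atTop (𝓝 ((Real.exp (-a) + Real.exp a) / 2)) := by
  have hd : Tendsto (fun v => a / Real.sqrt v) atTop (𝓝 0) :=
    tendsto_const_nhds.div_atTop Real.tendsto_sqrt_atTop
  have hp := tendsto_gaussPrimitive_atTop.comp (Real.tendsto_sqrt_atTop.atTop_add hd)
  have hm := tendsto_gaussPrimitive_atTop.comp (Real.tendsto_sqrt_atTop.atTop_add hd.neg)
  have h := ((hm.const_mul (Real.exp (-a))).add (hp.const_mul (Real.exp a))).const_mul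
    (Real.sqrt (2 * Real.pi))⁻¹
  have hpi : Real.sqrt (2 * Real.pi) ≠ 0 := by positivity
  convert! h using 2
  field_simp

lemma tendsto_mixturePrimitive_zero {a : ℝ} (ha : 0 ≤ a) :
    Tendsto (mixturePrimitive a) (𝓝[>] 0) (𝓝 ((Real.exp a - Real.exp (-a)) / 2)) := by
  have hs : Tendsto Real.sqrt (𝓝[>] 0) (𝓝 0) := by
    simpa using (Real.continuous_sqrt.tendsto 0).mono_left nhdsWithin_le_nhds
  rcases ha.eq_or_lt with rfl | ha
  · have hg := (hasDerivAt_gaussPrimitive 0).continuousAt.tendsto.comp hs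
    have h := (hg.add hg).const_mul (Real.sqrt (2 * Real.pi))⁻¹
    have h0 : gaussPrimitive 0 = 0 := by simp [gaussPrimitive]
    have he : mixturePrimitive 0 = fun v => (Real.sqrt (2 * Real.pi))⁻¹ *
        (gaussPrimitive (Real.sqrt v) + gaussPrimitive (Real.sqrt v)) := by
      ext v
      simp [mixturePrimitive]
    simpa [he, h0] using h
  · have hs' : Tendsto Real.sqrt (𝓝[>] 0) (𝓝[>] 0) :=
      tendsto_nhdsWithin_iff.2 ⟨hs, eventually_mem_nhdsWithin.mono fun v hv => Real.sqrt_pos.2 hv⟩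
    have hd : Tendsto (fun v => a / Real.sqrt v) (𝓝[>] 0) atTop :=
      (tendsto_inv_nhdsGT_zero.comp hs').const_mul_atTop ha
    have hp := tendsto_gaussPrimitive_atTop.comp (hs.add_atTop hd)
    have hm := tendsto_gaussPrimitive_atBot.comp
      (hs.add_atBot (tendsto_neg_atTop_atBot.comp hd))
    have h := ((hm.const_mul (Real.exp (-a))).add (hp.const_mul (Real.exp a))).const_mul
      (Real.sqrt (2 * Real.pi))⁻¹
    have hpi : Real.sqrt (2 * Real.pi) ≠ 0 := by positivity
    convert! h using 2
    field_simp
    ring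

lemma integral_inv_sqrt_mul_exp {a : ℝ} (ha : 0 ≤ a) :
    ∫ v in Ioi (0 : ℝ),
      (Real.sqrt (2 * Real.pi * v))⁻¹ * Real.exp (-a ^ 2 / (2 * v) - v / 2) = Real.exp (-a) := by
  rw [integral_Ioi_of_hasDerivAt_of_nonneg
    (g := Function.update (mixturePrimitive a) 0 ((Real.exp a - Real.exp (-a)) / 2))
    (l := (Real.exp (-a) + Real.exp a) / 2)]
  · rw [Function.update_self]
    ring
  · rw [continuousWithinAt_update_same]
    simpa using tendsto_mixturePrimitive_zero ha
  · intro v hv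
    refine (hasDerivAt_mixturePrimitive a hv).congr_of_eventuallyEq ?_
    filter_upwards [isOpen_ne.mem_nhds (ne_of_gt hv)] with w hw
    exact Function.update_of_ne hw _ _
  · intro v _
    positivity
  · refine (tendsto_mixturePrimitive_atTop a).congr' ?_
    filter_upwards [eventually_gt_atTop 0] with w hw
    exact (Function.update_of_ne hw.ne' _ _).symm

/-- The quantile-regression pseudo-likelihood `exp(−2 ρ_q(θ))`, whose negative logarithm is
the check loss `|θ| + (2q − 1)θ`, is a normal variance-mean mixture with exponentially
tilted improper mixing density. -/
theorem check_loss_is_variance_mean_mixture (q : ℝ) (hq : q ∈ Ioo (0 : ℝ) 1) (θ : ℝ) :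
    (∫ v in Ioi (0 : ℝ),
        normalPdf θ ((1 - 2 * q) * v) v * Real.exp (-2 * q * (1 - q) * v)) =
      Real.exp (-2 * checkLoss q θ) := by
  have h : ∀ v ∈ Ioi (0 : ℝ),
      normalPdf θ ((1 - 2 * q) * v) v * Real.exp (-2 * q * (1 - q) * v) =
        Real.exp ((1 - 2 * q) * θ) *
          ((Real.sqrt (2 * Real.pi * v))⁻¹ * Real.exp (-|θ| ^ 2 / (2 * v) - v / 2)) := by
    intro v hv
    have hv0 : v ≠ 0 := ne_of_gt hv
    rw [normalPdf, mul_assoc, ← Real.exp_add, mul_left_comm, ← Real.exp_add, sq_abs]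
    congr 2
    field_simp
    ring
  rw [setIntegral_congr_fun measurableSet_Ioi h, integral_const_mul,
    integral_inv_sqrt_mul_exp (abs_nonneg θ), ← Real.exp_add, checkLoss]
  congr 1
  ring
end

section
/- (Proposition 1, score identity for normal variance-mean mixtures.) Let P be a σ-finite measure on (0, ∞), let μ, κ be real and τ > 0, and define p(θ) = ∫₀^∞ φ(θ; μ + κ/λ, τ²/λ) dP(λ). Fix θ₀ with p(θ₀) ∈ (0, ∞), and assume ∫₀^∞ λ·φ(θ₀; μ + κ/λ, τ²/λ) dP(λ) < ∞ and that differentiation under the integral sign is justified at θ₀ (for example, there exist ε > 0 and a P-integrable function G with |∂φ(θ; μ + κ/λ, τ²/λ)/∂θ| ≤ G(λ) for all |θ − θ₀| < ε and λ > 0). Define the conditional expectation E(λ | θ₀) = (∫₀^∞ λ·φ(θ₀; μ + κ/λ, τ²/λ) dP(λ)) / p(θ₀) and the penalty g(θ) = −log p(θ). Then g is differentiable at θ₀ and (θ₀ − μ)·E(λ | θ₀) = κ + τ²·g′(θ₀). The same identity applied to the likelihood mixture p(z) = ∫₀^∞ φ(z; μ_z + κ_z/ω, σ²/ω) dP(ω)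 with f(z) = −log p(z) yields (z − μ_z)·E(ω | z) = κ_z + σ²·f′(z). -/
open Real MeasureTheory Set

theorem hasDerivAt_normalPdf (m : ℝ) {v : ℝ} (hv : v ≠ 0) (x : ℝ) :
    HasDerivAt (fun t => normalPdf t m v) (-((x - m) / v) * normalPdf x m v) x := by
  unfold normalPdf
  have h : HasDerivAt (fun t : ℝ => -(t - m) ^ 2 / (2 * v)) (-((x - m) / v)) x := by
    refine ((((hasDerivAt_id' x).sub_const m).pow 2).neg.div_const (2 * v)).congr_deriv ?_
    field_simp
    norm_num [mul_comm]
  refine (h.exp.const_mul (Real.sqrt (2 * Real.pi * v))⁻¹).congr_deriv ?_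
  ring

theorem hasDerivAt_normalPdf_varianceMean (μ κ : ℝ) {τ l : ℝ} (hτ : τ ≠ 0) (hl : l ≠ 0) (x : ℝ) :
    HasDerivAt (fun t => normalPdf t (μ + κ / l) (τ ^ 2 / l))
      ((κ - (x - μ) * l) / τ ^ 2 * normalPdf x (μ + κ / l) (τ ^ 2 / l)) x := by
  convert hasDerivAt_normalPdf (μ + κ / l) (div_ne_zero (pow_ne_zero 2 hτ) hl) x using 2
  field_simp
  ring

theorem measurable_normalPdf_varianceMean (μ κ τ x : ℝ) :
    Measurable fun l => normalPdf x (μ + κ / l) (τ ^ 2 / l) := by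
  unfold normalPdf
  fun_prop

/-- Proposition 1 (score identity for normal variance-mean mixtures).  If
`p(θ) = ∫₀^∞ φ(θ; μ + κ/λ, τ²/λ) dP(λ)` is a normal variance-mean mixture with σ-finite
mixing measure `P` on `(0, ∞)`, `p(θ₀) ∈ (0, ∞)`, the conditional first moment of `λ`
given `θ₀` is finite, and differentiation under the integral sign is justified at `θ₀`
(via a local integrable dominating function for the θ-derivative of the kernel), then the
penalty `g = −log p` is differentiable at `θ₀` and
`(θ₀ − μ)·E(λ | θ₀) = κ + τ²·g′(θ₀)`.  Applied to the likelihood mixture, the same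
identity reads `(z − μ_z)·E(ω | z) = κ_z + σ²·f′(z)`. -/
theorem score_identity_variance_mean_mixture
    (P : Measure ℝ) [SigmaFinite P] (μ κ τ : ℝ) (hτ : 0 < τ)
    (p : ℝ → ℝ)
    (hp : ∀ θ, p θ = ∫ l in Ioi (0 : ℝ), normalPdf θ (μ + κ / l) (τ ^ 2 / l) ∂P)
    (θ₀ : ℝ)
    (hp_pos : 0 < p θ₀)
    (hp_int : IntegrableOn (fun l => normalPdf θ₀ (μ + κ / l) (τ ^ 2 / l)) (Ioi 0) P)
    (hmom_int :
      IntegrableOn (fun l => l * normalPdf θ₀ (μ + κ / l) (τ ^ 2 / l)) (Ioi 0) P)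
    (ε : ℝ) (hε : 0 < ε) (G : ℝ → ℝ) (hG : IntegrableOn G (Ioi 0) P)
    (hdom : ∀ θ, |θ - θ₀| < ε → ∀ l ∈ Ioi (0 : ℝ),
      |deriv (fun t => normalPdf t (μ + κ / l) (τ ^ 2 / l)) θ| ≤ G l) :
    DifferentiableAt ℝ (fun θ => -Real.log (p θ)) θ₀ ∧
    (θ₀ - μ) *
        ((∫ l in Ioi (0 : ℝ), l * normalPdf θ₀ (μ + κ / l) (τ ^ 2 / l) ∂P) / p θ₀) =
      κ + τ ^ 2 * deriv (fun θ => -Real.log (p θ)) θ₀ := by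
  have hp_deriv := (hasDerivAt_integral_of_dominated_loc_of_deriv_le
    (μ := P.restrict (Ioi 0)) (F := fun θ l => normalPdf θ (μ + κ / l) (τ ^ 2 / l))
    (F' := fun θ l => (κ - (θ - μ) * l) / τ ^ 2 * normalPdf θ (μ + κ / l) (τ ^ 2 / l))
    (Metric.ball_mem_nhds θ₀ hε)
    (.of_forall fun θ => (measurable_normalPdf_varianceMean μ κ τ θ).aestronglyMeasurable)
    hp_int
    ((by fun_prop : Measurable fun l : ℝ => (κ - (θ₀ - μ) * l) / τ ^ 2).mul
      (measurable_normalPdf_varianceMean μ κ τ θ₀)).aestronglyMeasurable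
    (by
      filter_upwards [ae_restrict_mem measurableSet_Ioi] with l hl θ hθ
      rw [Real.norm_eq_abs,
        ← (hasDerivAt_normalPdf_varianceMean μ κ hτ.ne' (ne_of_gt hl) θ).deriv]
      exact hdom θ (by simpa [Real.dist_eq] using hθ) l hl)
    hG
    (by
      filter_upwards [ae_restrict_mem measurableSet_Ioi] with l hl θ _
      exact hasDerivAt_normalPdf_varianceMean μ κ hτ.ne' (ne_of_gt hl) θ)).2
  rw [← funext hp] at hp_deriv
  have hscore : ∫ l in Ioi (0 : ℝ),
        (κ - (θ₀ - μ) * l) / τ ^ 2 * normalPdf θ₀ (μ + κ / l) (τ ^ 2 / l) ∂P =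
      κ / τ ^ 2 * p θ₀ - (θ₀ - μ) / τ ^ 2 *
        ∫ l in Ioi (0 : ℝ), l * normalPdf θ₀ (μ + κ / l) (τ ^ 2 / l) ∂P := by
    rw [hp θ₀, ← integral_const_mul, ← integral_const_mul,
      ← integral_sub (hp_int.const_mul _) (hmom_int.const_mul _)]
    congr 1
    ext l
    ring
  rw [hscore] at hp_deriv
  have hg := (hp_deriv.log hp_pos.ne').neg
  refine ⟨hg.differentiableAt, ?_⟩
  have hg' := hg.deriv
  simp only [Pi.neg_def] at hg'
  rw [hg']
  field_simp
  ring
end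

section
/- (Logistic expectation-step weight.) Let P be a σ-finite measure on (0, ∞) such that ∫₀^∞ φ(z; v/2, v) dP(v) = e^z/(1 + e^z) for every real z, and such that ∫₀^∞ v^{-1}·φ(z; v/2, v) dP(v) is finite for every z and differentiation under the integral sign with respect to z is justified (e.g., locally dominated). Then for every real z ≠ 0, the conditional expectation of ω = v^{-1} given z satisfies E(ω | z) = (∫₀^∞ v^{-1}·φ(z; v/2, v) dP(v)) / (e^z/(1 + e^z)) = (1/z)·( e^z/(1 + e^z) − 1/2 ) = tanh(z/2)/(2z). -/
open Real MeasureTheory Set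

theorem hasDerivAt_normalPdf_half_mean (z : ℝ) {v : ℝ} (hv : 0 < v) :
    HasDerivAt (fun t => normalPdf t (v / 2) v)
      (1 / 2 * normalPdf z (v / 2) v - z * (v⁻¹ * normalPdf z (v / 2) v)) z := by
  have hexponent : HasDerivAt (fun t : ℝ => -(t - v / 2) ^ 2 / (2 * v))
      (-(2 * (z - v / 2)) / (2 * v)) z := by
    have h := ((((hasDerivAt_id z).sub_const (v / 2)).pow 2).neg).div_const (2 * v)
    simpa using h
  have h := (hexponent.exp).const_mul (Real.sqrt (2 * Real.pi * v))⁻¹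
  refine h.congr_deriv ?_
  unfold normalPdf
  have hv' := hv.ne'
  generalize (Real.sqrt (2 * Real.pi * v))⁻¹ = c
  generalize Real.exp (-(z - v / 2) ^ 2 / (2 * v)) = e
  field_simp
  ring

theorem hasDerivAt_exp_div_one_add_exp (z : ℝ) :
    HasDerivAt (fun t : ℝ => Real.exp t / (1 + Real.exp t))
      (Real.exp z / (1 + Real.exp z) * (1 - Real.exp z / (1 + Real.exp z))) z := by
  have hpos : 1 + Real.exp z ≠ 0 := by positivity
  refine ((Real.hasDerivAt_exp z).div ((Real.hasDerivAt_exp z).const_add 1) hpos).congr_deriv ?_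
  field_simp

theorem exp_div_one_add_exp_sub_half (z : ℝ) :
    Real.exp z / (1 + Real.exp z) - 1 / 2 = Real.tanh (z / 2) / 2 := by
  have hz : Real.exp z = Real.exp (z / 2) ^ 2 := by
    rw [← Real.exp_nat_mul]
    congr 1
    push_cast
    ring
  rw [Real.tanh_eq_sinh_div_cosh, Real.sinh_eq, Real.cosh_eq, Real.exp_neg, hz]
  field_simp
  ring

/-- The logistic expectation-step weight.  If a σ-finite mixing measure `P` on `(0, ∞)`
represents the binary logistic pseudo-likelihood as the normal variance-mean mixture
`∫₀^∞ φ(z; v/2, v) dP(v) = e^z/(1 + e^z)`, the conditional first moment of `ω = v⁻¹`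
given `z` is finite, and differentiation under the integral sign in `z` is justified,
then for every `z ≠ 0` the expectation-step weight is
`E(ω | z) = (1/z)(e^z/(1 + e^z) − 1/2) = tanh(z/2)/(2z)`. -/
theorem logistic_expectation_step_weight
    (P : Measure ℝ) [SigmaFinite P]
    (hrep : ∀ z : ℝ,
      (∫ v in Ioi (0 : ℝ), normalPdf z (v / 2) v ∂P) = Real.exp z / (1 + Real.exp z))
    (hfin : ∀ z : ℝ, IntegrableOn (fun v => v⁻¹ * normalPdf z (v / 2) v) (Ioi 0) P)
    (hDUI : ∀ z : ℝ, HasDerivAt (fun t => ∫ v in Ioi (0 : ℝ), normalPdf t (v / 2) v ∂P)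
      (∫ v in Ioi (0 : ℝ), deriv (fun t => normalPdf t (v / 2) v) z ∂P) z) :
    ∀ z : ℝ, z ≠ 0 →
      (∫ v in Ioi (0 : ℝ), v⁻¹ * normalPdf z (v / 2) v ∂P) /
          (Real.exp z / (1 + Real.exp z)) =
        (1 / z) * (Real.exp z / (1 + Real.exp z) - 1 / 2) ∧
      (1 / z) * (Real.exp z / (1 + Real.exp z) - 1 / 2) = Real.tanh (z / 2) / (2 * z) := by
  intro z hz
  refine ⟨?_, by rw [exp_div_one_add_exp_sub_half]; field_simp⟩
  have hL : 0 < Real.exp z / (1 + Real.exp z) := by positivity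
  have hint : IntegrableOn (fun v => normalPdf z (v / 2) v) (Ioi 0) P := by
    by_contra hnot
    have h := hrep z
    rw [integral_undef hnot] at h
    exact hL.ne h
  have hderiv : ∫ v in Ioi (0 : ℝ), deriv (fun t => normalPdf t (v / 2) v) z ∂P =
      1 / 2 * (Real.exp z / (1 + Real.exp z)) -
        z * ∫ v in Ioi (0 : ℝ), v⁻¹ * normalPdf z (v / 2) v ∂P := by
    rw [setIntegral_congr_fun measurableSet_Ioi
        (fun v hv => (hasDerivAt_normalPdf_half_mean z hv).deriv),
      integral_sub (hint.const_mul _) ((hfin z).const_mul _),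
      integral_const_mul, integral_const_mul, hrep]
  have hlogistic := hDUI z
  simp only [hrep] at hlogistic
  have key := hlogistic.unique (hasDerivAt_exp_div_one_add_exp z)
  rw [hderiv] at key
  rw [div_eq_iff hL.ne', one_div, mul_assoc, eq_inv_mul_iff_mul_eq₀ hz]
  linear_combination -key
end

section
/- (Holmes–Held multinomial-to-binary reduction.) Let K ≥ 2, let a₁, …, a_K be real numbers, fix k ∈ {1, …, K}, and set c_k = log Σ_{l ≠ k} exp(a_l). Then: (i) exp(a_k)/Σ_{l=1}^K exp(a_l) = exp(a_k − c_k)/(1 + exp(a_k − c_k)); and (ii) for every j ≠ k, exp(a_j)/Σ_{l=1}^K exp(a_l) = w_j·(1 − exp(a_k − c_k)/(1 + exp(a_k − c_k))), where w_j = exp(a_j − c_k) depends only on {a_l : l ≠ k} and not on a_k. -/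
open Real Finset

/-- Holmes–Held multinomial-to-binary reduction.  With `c_k = log Σ_{l ≠ k} exp(a_l)`:
(i) the softmax probability of class `k` equals the binary logistic probability with
offset `c_k`; (ii) for each `j ≠ k`, the softmax probability of class `j` equals
`w_j·(1 − exp(a_k − c_k)/(1 + exp(a_k − c_k)))` with `w_j = exp(a_j − c_k)`; and (iii)
`w_j` depends only on `{a_l : l ≠ k}` and not on `a_k`. -/
theorem holmes_held_multinomial_reduction
    (K : ℕ) (hK : 2 ≤ K) (a : Fin K → ℝ) (k : Fin K)
    (c : ℝ) (hc : c = Real.log (∑ l ∈ Finset.univ.erase k, Real.exp (a l))) :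
    Real.exp (a k) / (∑ l, Real.exp (a l)) =
        Real.exp (a k - c) / (1 + Real.exp (a k - c)) ∧
    (∀ j : Fin K, j ≠ k →
      Real.exp (a j) / (∑ l, Real.exp (a l)) =
        Real.exp (a j - c) *
          (1 - Real.exp (a k - c) / (1 + Real.exp (a k - c)))) ∧
    (∀ j : Fin K, j ≠ k → ∀ a' : Fin K → ℝ, (∀ l : Fin K, l ≠ k → a' l = a l) →
      Real.exp (a' j - Real.log (∑ l ∈ Finset.univ.erase k, Real.exp (a' l))) =
        Real.exp (a j - c)) := by
  have hS : 0 < ∑ l ∈ Finset.univ.erase k, Real.exp (a l) := by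
    refine Finset.sum_pos (fun l _ => Real.exp_pos _) ?_
    rw [← Finset.card_pos, Finset.card_erase_of_mem (Finset.mem_univ k), Finset.card_univ,
      Fintype.card_fin]
    omega
  have hsum : ∑ l, Real.exp (a l) = Real.exp (a k) + Real.exp c := by
    rw [hc, Real.exp_log hS, Finset.add_sum_erase _ (fun l => Real.exp (a l)) (Finset.mem_univ k)]
  refine ⟨?_, fun j _ => ?_, fun j hj a' ha' => ?_⟩
  · rw [hsum, Real.exp_sub]
    field_simp
    ring
  · rw [hsum, Real.exp_sub, Real.exp_sub]
    field_simp
    ring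
  · rw [hc, ha' j hj, Finset.sum_congr rfl fun l hl => by rw [ha' l (Finset.ne_of_mem_erase hl)]]
end

section
/- For every real z ≠ 0, the iteratively re-weighted least squares weight for logistic regression is strictly smaller than the expectation–maximization weight: e^z/(1 + e^z)² < (1/z)·( e^z/(1 + e^z) − 1/2 ); equivalently, (1/4)·sech²(z/2) < tanh(z/2)/(2z), with both sides equal to 1/4 at z = 0. Moreover the ratio of the two weights tends to zero as |z| → ∞: lim_{|z|→∞} [ e^z/(1 + e^z)² ] / [ (1/z)·( e^z/(1 + e^z) − 1/2 ) ] = 0. -/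
open Real Filter

theorem exp_div_one_add_exp_sq (z : ℝ) :
    exp z / (1 + exp z) ^ 2 = (1 / 4) * (1 / cosh (z / 2)) ^ 2 := by
  have hz : exp z = exp (z / 2) ^ 2 := by rw [← exp_nat_mul]; congr 1; push_cast; ring
  have h := exp_pos (z / 2)
  rw [cosh_eq, exp_neg, hz]
  field_simp
  ring

theorem one_div_mul_exp_div_one_add_exp_sub_half (z : ℝ) :
    (1 / z) * (exp z / (1 + exp z) - 1 / 2) = tanh (z / 2) / (2 * z) := by
  have hz : exp z = exp (z / 2) ^ 2 := by rw [← exp_nat_mul]; congr 1; push_cast; ring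
  have h := exp_pos (z / 2)
  have key : exp z / (1 + exp z) - 1 / 2 = tanh (z / 2) / 2 := by
    rw [tanh_eq_sinh_div_cosh, sinh_eq, cosh_eq, exp_neg, hz]
    field_simp
    ring
  rw [key]
  ring

theorem tanh_half_div_pos {z : ℝ} (hz : z ≠ 0) : 0 < tanh (z / 2) / (2 * z) := by
  rw [tanh_eq_sinh_div_cosh, div_div]
  have hc := cosh_pos (z / 2)
  rcases hz.lt_or_gt with h | h
  · exact div_pos_of_neg_of_neg (sinh_neg_iff.2 (by linarith))
      (mul_neg_of_pos_of_neg hc (by linarith))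
  · exact div_pos (sinh_pos_iff.2 (by linarith)) (by positivity)

theorem sech_half_sq_eq_tanh_half_mul {z : ℝ} (hz : z ≠ 0) :
    (1 / 4) * (1 / cosh (z / 2)) ^ 2 = z / sinh z * (tanh (z / 2) / (2 * z)) := by
  have hc := (cosh_pos (z / 2)).ne'
  have hs : sinh (z / 2) ≠ 0 := by simpa [sinh_eq_zero] using hz
  have h2 : sinh z = 2 * sinh (z / 2) * cosh (z / 2) := by
    rw [← sinh_two_mul]; congr 1; ring
  rw [h2, tanh_eq_sinh_div_cosh]
  field_simp
  norm_num

theorem div_sinh_lt_one {z : ℝ} (hz : z ≠ 0) : z / sinh z < 1 := by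
  rcases hz.lt_or_gt with h | h
  · exact (div_lt_one_of_neg (sinh_neg_iff.2 h)).2 (sinh_lt_self_iff.2 h)
  · exact (div_lt_one (sinh_pos_iff.2 h)).2 (self_lt_sinh_iff.2 h)

theorem sech_half_sq_lt_tanh_half_div {z : ℝ} (hz : z ≠ 0) :
    (1 / 4) * (1 / cosh (z / 2)) ^ 2 < tanh (z / 2) / (2 * z) := by
  rw [sech_half_sq_eq_tanh_half_mul hz]
  exact mul_lt_of_lt_one_left (tanh_half_div_pos hz) (div_sinh_lt_one hz)

theorem weight_ratio_eq_div_sinh {z : ℝ} (hz : z ≠ 0) :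
    (exp z / (1 + exp z) ^ 2) / ((1 / z) * (exp z / (1 + exp z) - 1 / 2)) = z / sinh z := by
  rw [exp_div_one_add_exp_sq, one_div_mul_exp_div_one_add_exp_sub_half,
    sech_half_sq_eq_tanh_half_mul hz, mul_div_cancel_right₀ _ (tanh_half_div_pos hz).ne']

theorem tendsto_div_sinh_atTop : Tendsto (fun z : ℝ => z / sinh z) atTop (nhds 0) := by
  have h1 := (tendsto_pow_mul_exp_neg_atTop_nhds_zero 1).const_mul 2
  have h2 := (tendsto_exp_neg_atTop_nhds_zero.pow 2).const_sub 1
  have h := h1.div h2 (by norm_num)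
  rw [mul_zero, zero_div] at h
  refine h.congr fun z => ?_
  have hz := exp_pos z
  simp only [Pi.div_apply]
  rw [sinh_eq, exp_neg, pow_one,
    show (exp z - (exp z)⁻¹) / 2 = exp z * (1 - (exp z)⁻¹ ^ 2) / 2 by field_simp]
  simp only [div_eq_mul_inv, mul_inv, inv_inv]
  ring

theorem tendsto_div_sinh_atBot : Tendsto (fun z : ℝ => z / sinh z) atBot (nhds 0) := by
  refine (tendsto_div_sinh_atTop.comp tendsto_neg_atBot_atTop).congr fun z => ?_
  simp [sinh_neg, neg_div_neg_eq]

theorem tendsto_tanh_half_div :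
    Tendsto (fun z : ℝ => tanh (z / 2) / (2 * z)) (nhdsWithin 0 {0}ᶜ) (nhds (1 / 4)) := by
  have hd : HasDerivAt (fun z : ℝ => sinh (z / 2)) (1 / 2) 0 := by
    simpa using ((hasDerivAt_id (0 : ℝ)).div_const 2).sinh
  have hc : Tendsto (fun z : ℝ => 2 * cosh (z / 2)) (nhdsWithin 0 {0}ᶜ) (nhds 2) := by
    have : Continuous fun z : ℝ => 2 * cosh (z / 2) := by fun_prop
    simpa using (this.tendsto 0).mono_left nhdsWithin_le_nhds
  have h := (hasDerivAt_iff_tendsto_slope.1 hd).div hc two_ne_zero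
  rw [show (1 / 2 / 2 : ℝ) = 1 / 4 by norm_num] at h
  refine h.congr fun z => ?_
  simp only [Pi.div_apply, slope_def_field, tanh_eq_sinh_div_cosh, zero_div, sinh_zero, sub_zero,
    div_div]
  ring

/-- For logistic regression, the iteratively re-weighted least squares weight
`e^z/(1 + e^z)²` is strictly smaller than the expectation–maximization weight
`(1/z)(e^z/(1 + e^z) − 1/2) = tanh(z/2)/(2z)` for every `z ≠ 0` (equivalently
`(1/4)sech²(z/2) < tanh(z/2)/(2z)`); both sides equal `1/4` at `z = 0` (the EM weight in
the limiting sense); and the ratio of the IRLS weight to the EM weight tends to `0` as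
`|z| → ∞`. -/
theorem irls_weight_lt_em_weight :
    (∀ z : ℝ, z ≠ 0 →
      Real.exp z / (1 + Real.exp z) ^ 2 <
        (1 / z) * (Real.exp z / (1 + Real.exp z) - 1 / 2)) ∧
    (∀ z : ℝ, z ≠ 0 →
      (1 / 4) * (1 / Real.cosh (z / 2)) ^ 2 < Real.tanh (z / 2) / (2 * z)) ∧
    (1 / 4 : ℝ) * (1 / Real.cosh ((0 : ℝ) / 2)) ^ 2 = 1 / 4 ∧
    Tendsto (fun z : ℝ => Real.tanh (z / 2) / (2 * z)) (nhdsWithin 0 {0}ᶜ)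
      (nhds (1 / 4)) ∧
    Tendsto
      (fun z : ℝ => (Real.exp z / (1 + Real.exp z) ^ 2) /
        ((1 / z) * (Real.exp z / (1 + Real.exp z) - 1 / 2))) atTop (nhds 0) ∧
    Tendsto
      (fun z : ℝ => (Real.exp z / (1 + Real.exp z) ^ 2) /
        ((1 / z) * (Real.exp z / (1 + Real.exp z) - 1 / 2))) atBot (nhds 0) := by
  refine ⟨fun z hz => ?_, fun z hz => sech_half_sq_lt_tanh_half_div hz, by simp,
    tendsto_tanh_half_div, ?_, ?_⟩
  · rw [exp_div_one_add_exp_sq, one_div_mul_exp_div_one_add_exp_sub_half]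
    exact sech_half_sq_lt_tanh_half_div hz
  · refine tendsto_div_sinh_atTop.congr' ?_
    filter_upwards [eventually_ne_atTop 0] with z hz using (weight_ratio_eq_div_sinh hz).symm
  · refine tendsto_div_sinh_atBot.congr' ?_
    filter_upwards [eventually_ne_atBot 0] with z hz using (weight_ratio_eq_div_sinh hz).symm
end
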